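/- Let A ∈ GL(2, ℤ) be hyperbolic with unstable slope κ_A, and suppose q is the minimal eventual period of the continued fraction expansion (a_n) of κ_A, i.e. q is the least positive integer for which there exists N with a_{n+q} = a_n for all n ≥ N. If q is even, then every C ∈ GL(2, ℤ) with C A C⁻¹ = A satisfies det C = 1. -/

import Mathlib

/-- The orbit of `x` under the Gauss (continued fraction) map:
`x₀ = x`, `x_{n+1} = 1/(xₙ - ⌊xₙ⌋)`. -/
noncomputable def cfracAux (x : ℝ) : ℕ → ℝ
  | 0 => x
  | n + 1 => 1 / Int.fract (cfracAux x n)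

/-- The continued fraction partial quotient sequence of `x`:
`a n = ⌊xₙ⌋` in the standard continued fraction algorithm. -/
noncomputable def cfrac (x : ℝ) (n : ℕ) : ℤ := ⌊cfracAux x n⌋

theorem cfracAux_succ' (x : ℝ) (n : ℕ) :
    cfracAux x (n + 1) = cfracAux (1 / Int.fract x) n := by
  induction n with
  | zero => rfl
  | succ n ih => rw [cfracAux, ih, cfracAux]

theorem cfracAux_add (x : ℝ) (m n : ℕ) :
    cfracAux x (m + n) = cfracAux (cfracAux x m) n := by
  induction n with
  | zero => rfl
  | succ n ih => rw [← add_assoc, cfracAux, ih, cfracAux]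

theorem irrational_cfracAux {x : ℝ} (hx : Irrational x) (n : ℕ) :
    Irrational (cfracAux x n) := by
  induction n with
  | zero => exact hx
  | succ n ih =>
    rw [cfracAux, one_div, irrational_inv_iff, Int.fract, irrational_sub_intCast_iff]
    exact ih

theorem Irrational.fract_pos {x : ℝ} (hx : Irrational x) : 0 < Int.fract x :=
  lt_of_le_of_ne (Int.fract_nonneg x) fun h => hx.ne_int ⌊x⌋ (by
    have := Int.floor_add_fract x
    rw [← h] at this
    linarith)

theorem one_lt_cfracAux_succ {x : ℝ} (hx : Irrational x) (n : ℕ) :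
    1 < cfracAux x (n + 1) := by
  rw [cfracAux, lt_div_iff₀ (irrational_cfracAux hx n).fract_pos, one_mul]
  exact Int.fract_lt_one _

theorem one_le_cfrac_succ {x : ℝ} (hx : Irrational x) (n : ℕ) : 1 ≤ cfrac x (n + 1) := by
  rw [cfrac, Int.le_floor]
  exact_mod_cast (one_lt_cfracAux_succ hx n).le

theorem cfracAux_sub_cfrac_mul_succ {x : ℝ} (hx : Irrational x) (n : ℕ) :
    (cfracAux x n - cfrac x n) * cfracAux x (n + 1) = 1 := by
  have h := (irrational_cfracAux hx n).fract_pos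
  rw [cfracAux, cfrac, Int.self_sub_floor, mul_one_div_cancel h.ne']

/-- A linear form `p z + r` that is positive at some `z > 1` and is unimodular with respect to a
form `q z + s` with positive coefficients has nonnegative coefficients. -/
theorem nonneg_of_unimodular {z : ℝ} (hz : 1 < z) {p r q s : ℤ} (hq : 1 ≤ q) (hs : 1 ≤ s)
    (hpos : 0 < p * z + r) (hdet : |p * s - q * r| = 1) : 0 ≤ p ∧ 0 ≤ r := by
  obtain ⟨h1, h2⟩ := abs_le.mp hdet.le
  constructor
  · by_contra! hp
    have hp' : (p : ℝ) ≤ -1 := by exact_mod_cast (by omega : p ≤ -1)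
    have : (1 : ℝ) < r := by nlinarith
    have : (1 : ℤ) < r := by exact_mod_cast this
    nlinarith
  · by_contra! hr
    have hr' : (r : ℝ) ≤ -1 := by exact_mod_cast (by omega : r ≤ -1)
    have : (0 : ℝ) < p := by
      by_contra! h
      nlinarith
    have : (0 : ℤ) < p := by exact_mod_cast this
    nlinarith

/-- If `x = (p z + r) / (q z + s)` with a unimodular integer matrix whose bottom row satisfies
`q ≥ s ≥ 0` (and a sign condition in the boundary cases), then `z` is a complete quotient of `x`,
and the determinant gives the parity of its index. -/
theorem exists_cfracAux_eq {z : ℝ} (hz : 1 < z) (n : ℕ) :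
    ∀ (x : ℝ) (p r q s : ℤ), q + s ≤ n → Irrational x → x * (q * z + s) = p * z + r →
      1 ≤ q → 0 ≤ s → s ≤ q → |p * s - q * r| = 1 →
      (s = 0 → p * s - q * r = -1) → (q = s → p * s - q * r = 1) →
      ∃ m, cfracAux x m = z ∧ p * s - q * r = (-1) ^ m := by
  induction n with
  | zero => intros; omega
  | succ n ih =>
    intro x p r q s hn hx hxz hq hs hsq hdet hs0 hqs
    have hfr := hx.fract_pos
    have hfr1 := Int.fract_lt_one x
    rcases hs.eq_or_lt with rfl | hs
    · have h := hs0 rfl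
      have hqr : q * r = 1 := by linarith
      have hq1 : q = 1 := Int.eq_one_of_mul_eq_one_right (by omega) hqr
      subst hq1
      obtain rfl : r = 1 := by linarith
      refine ⟨1, ?_, by simp⟩
      have hxp : x = p + 1 / z := by
        have : z ≠ 0 := by positivity
        field_simp
        push_cast at hxz
        linarith
      have hz1 : 1 / z < 1 := by rw [div_lt_one (by linarith)]; exact hz
      have hz0 : 0 < 1 / z := by positivity
      have : Int.fract x = 1 / z := by
        rw [Int.fract_eq_iff]
        exact ⟨hz0.le, hz1, p, by rw [hxp]; ring⟩
      rw [cfracAux, cfracAux, this, one_div_one_div]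
    · obtain ⟨p', hp'⟩ : ∃ p', p' = p - ⌊x⌋ * q := ⟨_, rfl⟩
      obtain ⟨r', hr'⟩ : ∃ r', r' = r - ⌊x⌋ * s := ⟨_, rfl⟩
      have hdet' : p' * s - q * r' = p * s - q * r := by rw [hp', hr']; ring
      have hq0 : (1 : ℝ) ≤ q := by exact_mod_cast hq
      have hs1 : (1 : ℝ) ≤ s := by exact_mod_cast hs
      have hD : 0 < q * z + s := by nlinarith
      have hN : Int.fract x * (q * z + s) = p' * z + r' := by
        rw [hp', hr', Int.fract]
        push_cast
        linarith
      obtain ⟨hp0, hr0⟩ := nonneg_of_unimodular hz (p := p') (r := r') hq hs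
        (by rw [← hN]; positivity) (by rw [hdet', hdet])
      obtain ⟨hpq, hrs⟩ := nonneg_of_unimodular hz (p := q - p') (r := s - r') hq hs
        (by push_cast; nlinarith) (by
          rw [show (q - p') * s - q * (s - r') = -(p' * s - q * r') by ring, abs_neg, hdet', hdet])
      have hy : Irrational (1 / Int.fract x) := irrational_cfracAux hx 1
      have hyz : 1 / Int.fract x * (p' * z + r') = q * z + s := by
        rw [← hN]; field_simp
      have key : q * r' - p' * s = -(p * s - q * r) := by rw [← hdet']; ring
      have main : p' + r' ≤ n ∧ 1 ≤ p' ∧ r' ≤ p' ∧ (r' = 0 → q * r' - p' * s = -1) ∧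
          (p' = r' → q * r' - p' * s = 1) := by
        rcases (abs_eq zero_le_one).mp hdet with h | h
        · rw [h] at key
          have h1 : 1 ≤ p' := by
            by_contra! h
            obtain rfl : p' = 0 := by omega
            nlinarith
          have h2 : r' < p' := by
            by_contra! h
            nlinarith
          have h3 : r' < s := by
            by_contra! h
            obtain rfl : r' = s := by omega
            nlinarith
          exact ⟨by omega, h1, h2.le, fun _ => key, fun h => by omega⟩
        · rw [h, neg_neg] at key
          have hlt : s < q := lt_of_le_of_ne hsq fun e => by have := hqs e.symm; omega
          have h1 : 1 ≤ r' := by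
            by_contra! h
            obtain rfl : r' = 0 := by omega
            nlinarith
          have h2 : r' ≤ p' := by
            by_contra! h
            nlinarith
          have h3 : p' < q ∨ r' < s := by
            by_contra! h
            obtain rfl : p' = q := by omega
            obtain rfl : r' = s := by omega
            nlinarith
          exact ⟨by omega, by omega, h2, fun h => by omega, fun _ => key⟩
      obtain ⟨h1, h2, h3, h4, h5⟩ := main
      obtain ⟨m, hm, hm'⟩ := ih (1 / Int.fract x) q s p' r' h1 hy hyz h2 hr0 h3
        (by rw [key, abs_neg, hdet]) h4 h5
      refine ⟨m + 1, by rw [cfracAux_succ', hm], ?_⟩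
      rw [pow_succ, ← hm', key]
      ring

/-- `x = (p xₖ + r) / (q xₖ + s)` with positive denominator, where `xₖ` is the `k`-th complete
quotient of `x` and the matrix has determinant `-(-1)ᵏ`. -/
def IsQuotientRelation (x : ℝ) (k : ℕ) (p r q s : ℤ) : Prop :=
  0 < q * cfracAux x k + s ∧ x * (q * cfracAux x k + s) = p * cfracAux x k + r ∧
    p * s - q * r = -(-1) ^ k

theorem IsQuotientRelation.succ {x : ℝ} (hx : Irrational x) {k : ℕ} {p r q s : ℤ}
    (h : IsQuotientRelation x k p r q s) :
    IsQuotientRelation x (k + 1) (cfrac x k * p + r) p (cfrac x k * q + s) q := by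
  obtain ⟨h1, h2, h3⟩ := h
  have hy : 0 < cfracAux x (k + 1) := zero_lt_one.trans (one_lt_cfracAux_succ hx k)
  have e := cfracAux_sub_cfrac_mul_succ hx k
  have expand (u v : ℤ) : ((cfrac x k * u + v : ℤ) : ℝ) * cfracAux x (k + 1) + u =
      (u * cfracAux x k + v) * cfracAux x (k + 1) := by
    push_cast
    linear_combination (-(u : ℝ)) * e
  refine ⟨?_, ?_, ?_⟩
  · rw [expand]; positivity
  · rw [expand, expand, ← h2]; ring
  · rw [pow_succ]; linear_combination (-1 : ℤ) * h3

theorem exists_isQuotientRelation_pos {x : ℝ} (hx : Irrational x) (n : ℕ) :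
    ∀ (k : ℕ) (p r q s : ℤ), -s ≤ n → 0 < q → IsQuotientRelation x (k + 1) p r q s →
      ∃ (k : ℕ) (p r q s : ℤ), 0 < q ∧ 0 < s ∧ IsQuotientRelation x (k + 1) p r q s := by
  induction n with
  | zero =>
    intro k p r q s hs hq h
    have := one_le_cfrac_succ hx k
    exact ⟨_, _, _, _, _, by push_cast at hs; nlinarith, hq, h.succ hx⟩
  | succ n ih =>
    intro k p r q s hs hq h
    have ha := one_le_cfrac_succ hx k
    by_cases h1 : 0 < cfrac x (k + 1) * q + s
    · exact ⟨_, _, _, _, _, h1, hq, h.succ hx⟩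
    have h' := (h.succ hx).succ hx
    refine ih _ _ _ _ _ ?_ ?_ h'
    · push_cast at hs; nlinarith
    · have hpos := h'.1
      by_contra! h2
      have hz := one_lt_cfracAux_succ hx (k + 2)
      have h1' : ((cfrac x (k + 1) * q + s : ℤ) : ℝ) ≤ 0 := by exact_mod_cast not_lt.mp h1
      have h2' : ((cfrac x (k + 1 + 1) * (cfrac x (k + 1) * q + s) + q : ℤ) : ℝ) ≤ 0 := by
        exact_mod_cast h2
      nlinarith

/-- An irrational number fixed by a matrix of determinant `-1` has two complete quotients that
agree and whose indices have different parity. -/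
theorem exists_cfracAux_eq_of_fixed {x : ℝ} (hx : Irrational x) {p r q s : ℤ}
    (hpos : 0 < q * x + s) (hfix : x * (q * x + s) = p * x + r) (hdet : p * s - q * r = -1) :
    ∃ k m : ℕ, cfracAux x m = cfracAux x k ∧ Odd (m + k) := by
  have h1 := IsQuotientRelation.succ hx (k := 0) (p := p) (r := r) (q := q) (s := s)
    ⟨hpos, hfix, by simpa using hdet⟩
  have hex : ∃ (k : ℕ) (p r q s : ℤ), 0 < q ∧ IsQuotientRelation x (k + 1) p r q s := by
    by_cases hq : 0 < cfrac x 0 * q + s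
    · exact ⟨_, _, _, _, _, hq, h1⟩
    · refine ⟨_, _, _, _, _, ?_, h1.succ hx⟩
      have hp := (h1.succ hx).1
      by_contra! h2
      have hz := one_lt_cfracAux_succ hx 1
      have h1' : ((cfrac x 0 * q + s : ℤ) : ℝ) ≤ 0 := by exact_mod_cast not_lt.mp hq
      have h2' : ((cfrac x (0 + 1) * (cfrac x 0 * q + s) + q : ℤ) : ℝ) ≤ 0 := by
        exact_mod_cast h2
      nlinarith
  obtain ⟨k, p, r, q, s, hq, h⟩ := hex
  obtain ⟨k, p, r, q, s, hq, hs, h⟩ :=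
    exists_isQuotientRelation_pos hx (-s).toNat k p r q s (Int.self_le_toNat _) hq h
  have ha := one_le_cfrac_succ hx k
  have hlt : q < cfrac x (k + 1) * q + s := by nlinarith
  obtain ⟨-, h2, h3⟩ := h.succ hx
  obtain ⟨m, hm, hm'⟩ := exists_cfracAux_eq (one_lt_cfracAux_succ hx (k + 1))
    (cfrac x (k + 1) * q + s + q).toNat x _ _ _ _
    (Int.self_le_toNat _) hx h2 (by omega) hq.le hlt.le (by rw [h3]; simp)
    (fun h => by omega) (fun h => by omega)
  refine ⟨_, m, hm, ?_⟩
  rw [h3] at hm'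
  by_contra ho
  rw [Nat.not_odd_iff_even] at ho
  have h4 : (-1 : ℤ) ^ (m + (k + 1 + 1)) = 1 := ho.neg_one_pow
  have h5 : ((-1 : ℤ) ^ (k + 1 + 1)) * (-1) ^ (k + 1 + 1) = 1 := by
    rw [← mul_pow]; simp
  rw [pow_add, ← hm'] at h4
  linarith

theorem dvd_of_isLeast_eventual_period {α : Type*} {a : ℕ → α} {q p N : ℕ}
    (hq : IsLeast {q' : ℕ | 0 < q' ∧ ∃ N : ℕ, ∀ n ≥ N, a (n + q') = a n} q)
    (hp : ∀ n ≥ N, a (n + p) = a n) : q ∣ p := by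
  obtain ⟨⟨hq0, M, hM⟩, hmin⟩ := hq
  have hmul (t n : ℕ) (hn : M ≤ n) : a (n + q * t) = a n := by
    induction t with
    | zero => rfl
    | succ t ih => rw [mul_add_one, ← add_assoc, hM _ (by omega), ih]
  by_contra hdvd
  have hmod : 0 < p % q := Nat.pos_of_ne_zero fun h => hdvd (Nat.dvd_of_mod_eq_zero h)
  refine (hmin ⟨hmod, max M N, fun n hn => ?_⟩).not_gt (Nat.mod_lt _ hq0)
  rw [← hp n (le_of_max_le_right hn), ← hmul (p / q) (n + p % q) (by omega), add_assoc,
    Nat.mod_add_div]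

theorem even_of_cfracAux_eq {x : ℝ} {q k m : ℕ}
    (hq : IsLeast {q' : ℕ | 0 < q' ∧ ∃ N : ℕ, ∀ n ≥ N, cfrac x (n + q') = cfrac x n} q)
    (heven : Even q) (h : cfracAux x m = cfracAux x k) : Even (m + k) := by
  wlog hkm : k ≤ m generalizing k m
  · rw [add_comm]; exact this h.symm (by omega)
  obtain ⟨p, rfl⟩ := Nat.exists_eq_add_of_le hkm
  have hp : ∀ n ≥ k, cfrac x (n + p) = cfrac x n := fun n hn => by
    obtain ⟨t, rfl⟩ := Nat.exists_eq_add_of_le hn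
    rw [cfrac, cfrac, show k + t + p = (k + p) + t by omega, cfracAux_add, h, ← cfracAux_add]
  have := heven.trans_dvd (dvd_of_isLeast_eventual_period hq hp)
  rw [show k + p + k = 2 * k + p by omega]
  exact (even_two_mul k).add this

/-- The eigenvalue `lam` of a unimodular integer matrix is not an integer if `|lam| > 1`. -/
theorem ne_intCast_of_eigenvalue {κ lam : ℝ} {a b c d : ℤ} (hdet : |a * d - b * c| = 1)
    (h1 : a * κ + b = lam * κ) (h2 : c * κ + d = lam) (hlam : 1 < |lam|) (l : ℤ) : lam ≠ l := by
  rintro rfl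
  have h : l * (a + d - l) = a * d - b * c := by
    have : (l * (a + d - l) : ℝ) = a * d - b * c := by
      linear_combination (l - a : ℝ) * h2 + (c : ℝ) * h1
    exact_mod_cast this
  rw [← h, abs_mul] at hdet
  have := Int.eq_one_of_mul_eq_one_right (abs_nonneg l) hdet
  rw [← Int.cast_abs, this] at hlam
  simp at hlam

theorem irrational_of_eigenvector {κ lam : ℝ} {a b c d : ℤ} (hdet : |a * d - b * c| = 1)
    (h1 : a * κ + b = lam * κ) (h2 : c * κ + d = lam) (hlam : 1 < |lam|) : Irrational κ := by
  rintro ⟨x, rfl⟩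
  obtain ⟨u, v, huv⟩ : IsCoprime x.num (x.den : ℤ) := by
    rw [Int.isCoprime_iff_gcd_eq_one]; exact x.reduced
  have hx : (x : ℝ) * x.den = x.num := by exact_mod_cast x.mul_den_eq_num
  have huv' : (u * x.num + v * x.den : ℝ) = 1 := by exact_mod_cast huv
  refine ne_intCast_of_eigenvalue hdet h1 h2 hlam
    (u * (a * x.num + b * x.den) + v * (c * x.num + d * x.den)) ?_
  push_cast
  rw [← hx] at huv' ⊢
  linear_combination (-lam) * huv' - (u * x.den : ℝ) * h1 - (v * x.den : ℝ) * h2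

/-- If `A ∈ GL(2, ℤ)` is hyperbolic with unstable slope `κ` and the
minimal eventual period `q` of the continued fraction expansion of `κ` is even, then
every `C ∈ GL(2, ℤ)` with `C A C⁻¹ = A` has `det C = 1`. -/
theorem stmt_11
    (A : Matrix.GeneralLinearGroup (Fin 2) ℤ)
    (κ lam : ℝ)
    (hA : Matrix.mulVec ((A : Matrix (Fin 2) (Fin 2) ℤ).map (Int.cast : ℤ → ℝ)) ![κ, 1]
        = lam • ![κ, 1])
    (hlam : 1 < |lam|)
    (q : ℕ)
    (hq : IsLeast {q' : ℕ | 0 < q' ∧ ∃ N : ℕ, ∀ n ≥ N, cfrac κ (n + q') = cfrac κ n} q)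
    (heven : Even q) :
    ∀ C : Matrix.GeneralLinearGroup (Fin 2) ℤ,
      C * A * C⁻¹ = A → Matrix.det (C : Matrix (Fin 2) (Fin 2) ℤ) = 1 := by
  intro C hC
  have hunit (M : Matrix.GeneralLinearGroup (Fin 2) ℤ) :
      |M.1 0 0 * M.1 1 1 - M.1 0 1 * M.1 1 0| = 1 := by
    rw [← Matrix.det_fin_two, ← Int.isUnit_iff_abs_eq]
    exact (Matrix.isUnit_iff_isUnit_det _).mp M.isUnit
  have hAdet := hunit A
  have hCdet := hunit C
  have h1 := congrFun hA 0
  have h2 := congrFun hA 1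
  have hcomm : C.1 * A.1 = A.1 * C.1 := congrArg Units.val (mul_inv_eq_iff_eq_mul.mp hC)
  rw [← Matrix.ext_iff] at hcomm
  have hc0 := hcomm 1 0
  have hc1 := hcomm 1 1
  simp only [Matrix.mul_apply, Fin.sum_univ_two] at hc0 hc1
  simp only [Matrix.mulVec, dotProduct, Fin.sum_univ_two, Matrix.map_apply, Matrix.cons_val_zero,
    Matrix.cons_val_one, Pi.smul_apply, smul_eq_mul, mul_one] at h1 h2
  rw [Matrix.det_fin_two]
  generalize A.1 0 0 = a, A.1 0 1 = b, A.1 1 0 = c, A.1 1 1 = d at *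
  generalize C.1 0 0 = p, C.1 0 1 = r, C.1 1 0 = s, C.1 1 1 = t at *
  have hκ := irrational_of_eigenvector hAdet h1 h2 hlam
  have hc : (c : ℝ) ≠ 0 := fun hc => ne_intCast_of_eigenvalue hAdet h1 h2 hlam d (by
    rw [← h2, hc]; ring)
  have hc0' : (s * a + t * c : ℝ) = c * p + d * s := by exact_mod_cast hc0
  have hc1' : (s * b + t * d : ℝ) = c * r + d * t := by exact_mod_cast hc1
  have hfix : κ * (s * κ + t) = p * κ + r := by
    refine mul_left_cancel₀ hc ?_
    linear_combination (s * κ + t) * h2 + κ * hc0' + hc1' - s * h1 - t * h2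
  have hne : (s * κ + t : ℝ) ≠ 0 := by
    intro h0
    by_cases hs : s = 0
    · subst hs
      have ht : t = 0 := by simpa using h0
      subst ht
      simp at hCdet
    · exact ((hκ.intCast_mul hs).add_intCast t).ne_zero h0
  by_contra hdet
  have hdet' := ((abs_eq zero_le_one).mp hCdet).resolve_left hdet
  obtain ⟨k, m, hkm, hodd⟩ : ∃ k m : ℕ, cfracAux κ m = cfracAux κ k ∧ Odd (m + k) := by
    rcases hne.lt_or_gt with h | h
    · refine exists_cfracAux_eq_of_fixed hκ (p := -p) (r := -r) (q := -s) (s := -t) ?_ ?_ ?_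
      · push_cast; linarith
      · push_cast; linear_combination -hfix
      · linear_combination hdet'
    · exact exists_cfracAux_eq_of_fixed hκ h hfix (by linear_combination hdet')
  exact Nat.not_even_iff_odd.mpr hodd (even_of_cfracAux_eq hq heven hkm)
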